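/- arXiv:1909.02610 — 3 statements merged into one kernel-verified Lean document; each statement's English description precedes it below -/
import Mathlib

section
/- For every integer n ≥ 1, sdepth_{S_{n,3}}(I(P_{n,3})) > sdepth(S_{n,3}/I(P_{n,3})) = ⌈n/3⌉. -/
open MvPolynomial

section Defs

variable (K : Type) [Field K] (σ : Type)
variable (M : Type) [AddCommGroup M] [Module K M] [Module (MvPolynomial σ K) M]
  [IsScalarTower K (MvPolynomial σ K) M]

/-- The Stanley space `w K[A]`: the `K`-span of `{u • w : u a monomial in the variables of A}`. -/
noncomputable def stanleySpace (w : M) (A : Finset σ) : Submodule K M :=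
  Submodule.span K { m | ∃ u : σ →₀ ℕ, (↑u.support : Set σ) ⊆ ↑A ∧
    m = (monomial u (1 : K) : MvPolynomial σ K) • w }

/-- `(w, A)` indexed by `Fin r` gives a Stanley decomposition of `M`:
each Stanley space `wᵢ K[Aᵢ]` is a free `K[Aᵢ]`-module and `M` is their internal direct
sum as a `K`-vector space. -/
def IsStanleyDecomp {r : ℕ} (w : Fin r → M) (A : Fin r → Finset σ) : Prop :=
  (∀ i (f : MvPolynomial σ K), (↑f.vars : Set σ) ⊆ ↑(A i) → f • w i = 0 → f = 0) ∧
  (iSupIndep fun i => stanleySpace K σ M (w i) (A i)) ∧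
  (⨆ i, stanleySpace K σ M (w i) (A i)) = ⊤

/-- The Stanley depth of `M`: the largest value of `minᵢ |Aᵢ|` over all Stanley
decompositions of `M`. -/
noncomputable def sdepth : ℕ :=
  sSup { d | ∃ r, ∃ w : Fin r → M, ∃ A : Fin r → Finset σ,
    IsStanleyDecomp K σ M w A ∧ d = sInf (Set.range fun i => (A i).card) }

/-- The depth of `M` with respect to the maximal graded ideal `(x₁, …, x_N)`:
the maximal length of an `M`-regular sequence of elements of that ideal. -/
noncomputable def rdepth : ℕ :=
  sSup { d | ∃ rs : List (MvPolynomial σ K), rs.length = d ∧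
    (∀ f ∈ rs, f ∈ Ideal.span (Set.range (X : σ → MvPolynomial σ K))) ∧
    RingTheory.Sequence.IsRegular M rs }

end Defs

/-- Adjacency in the strong product `Pₙ ⊠ Pₘ` (vertices `(i,j)`, `0`-indexed): distinct
vertices are adjacent iff both coordinates differ by at most `1`. -/
def pAdj (n m : ℕ) (a b : Fin n × Fin m) : Prop :=
  a ≠ b ∧ |((a.1 : ℤ) - (b.1 : ℤ))| ≤ 1 ∧ |((a.2 : ℤ) - (b.2 : ℤ))| ≤ 1

/-- Adjacency in the strong product `Cₙ ⊠ Pₘ` (vertices `(i,j)`, `0`-indexed). -/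
def cAdj (n m : ℕ) (a b : Fin n × Fin m) : Prop :=
  a ≠ b ∧ min ((a.1 : ℤ) - (b.1 : ℤ)).natAbs (n - ((a.1 : ℤ) - (b.1 : ℤ)).natAbs) ≤ 1 ∧
    |((a.2 : ℤ) - (b.2 : ℤ))| ≤ 1

/-- The edge ideal of the graph with vertex set `V` and adjacency relation `Adj`. -/
noncomputable def edgeIdeal (K : Type) [Field K] {V : Type} (Adj : V → V → Prop) :
    Ideal (MvPolynomial V K) :=
  Ideal.span { p | ∃ a b : V, Adj a b ∧ p = X a * X b }

section Aux

variable {K : Type} [Field K] {σ : Type}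
variable {M : Type} [AddCommGroup M] [Module K M] [Module (MvPolynomial σ K) M]
  [IsScalarTower K (MvPolynomial σ K) M]

lemma sdepthSet_bddAbove [Fintype σ] : BddAbove { d | ∃ r, ∃ w : Fin r → M, ∃ A : Fin r → Finset σ,
    IsStanleyDecomp K σ M w A ∧ d = sInf (Set.range fun i => (A i).card) } := by
  refine ⟨Fintype.card σ, ?_⟩
  rintro d ⟨r, w, A, -, rfl⟩
  rcases isEmpty_or_nonempty (Fin r) with h | ⟨⟨i⟩⟩
  · rw [Set.range_eq_empty, Nat.sInf_empty]
    exact Nat.zero_le _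
  · exact (Nat.sInf_le (Set.mem_range_self i)).trans (Finset.card_le_univ (A i))

/-- Exponent vector of the squarefree monomial with support `C`. -/
noncomputable def sqf [Fintype σ] [DecidableEq σ] (C : Finset σ) : σ →₀ ℕ :=
  Finsupp.equivFunOnFinite.symm (fun i => if i ∈ C then 1 else 0)

lemma sqf_apply [Fintype σ] [DecidableEq σ] (C : Finset σ) (i : σ) :
    sqf C i = if i ∈ C then 1 else 0 := rfl

lemma sqf_support [Fintype σ] [DecidableEq σ] (C : Finset σ) : (sqf C).support = C := by
  ext i; simp [sqf_apply]

theorem sdepth_ge [Fintype σ] [DecidableEq σ] (Q : Finset σ → Prop) (fr : Finset σ → Finset σ)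
    (b : (σ →₀ ℕ) → M) (d : ℕ)
    (hb : ∀ u v : σ →₀ ℕ, Q u.support → Q (v + u).support →
      (monomial v (1 : K)) • b u = b (v + u))
    (hli : LinearIndepOn K b {u | Q u.support})
    (hsp : ⊤ ≤ Submodule.span K (b '' {u | Q u.support}))
    (hfr : ∀ F F', Q F → F \ fr F ⊆ F' → F' ⊆ F ∪ fr F → Q F' ∧ fr F' = fr F)
    (hd : ∀ F, Q F → d ≤ (F ∪ fr F).card) (hex : ∃ F, Q F) : d ≤ sdepth K σ M := by
  classical
  let B := {C : Finset σ // Q C ∧ Disjoint C (fr C)}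
  let U : B → Set (σ →₀ ℕ) := fun C => {u | C.1 ⊆ u.support ∧ u.support ⊆ C.1 ∪ fr C.1}
  have base : ∀ F, Q F → Q (F \ fr F) ∧ fr (F \ fr F) = fr F := fun F hF =>
    hfr F _ hF subset_rfl (Finset.sdiff_subset.trans Finset.subset_union_left)
  have hUQ : ∀ C : B, ∀ u ∈ U C, Q u.support ∧ fr u.support = fr C.1 := fun C u hu =>
    hfr C.1 _ C.2.1 (Finset.sdiff_subset.trans hu.1) hu.2
  have hUsub : ∀ C : B, U C ⊆ {u | Q u.support} := fun C u hu => (hUQ C u hu).1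
  have hUdisj : ∀ C D : B, ∀ u, u ∈ U C → u ∈ U D → C = D := by
    have key : ∀ C : B, ∀ u, u ∈ U C → C.1 = u.support \ fr u.support := by
      intro C u hu
      rw [(hUQ C u hu).2]
      ext i
      have h1 := @hu.1 i
      have h2 := @hu.2 i
      have h3 : i ∈ C.1 → i ∉ fr C.1 := fun h h' => Finset.disjoint_left.1 C.2.2 h h'
      simp only [Finset.mem_sdiff, Finset.mem_union] at *
      tauto
    intro C D u hC hD
    exact Subtype.ext ((key C u hC).trans (key D u hD).symm)
  have hspace : ∀ C : B, stanleySpace K σ M (b (sqf C.1)) (C.1 ∪ fr C.1)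
      = Submodule.span K (b '' U C) := by
    intro C
    unfold stanleySpace
    congr 1
    ext m
    constructor
    · rintro ⟨v, hv, rfl⟩
      have hU : v + sqf C.1 ∈ U C := by
        have hs : (v + sqf C.1).support = v.support ∪ C.1 := by
          ext i; simp [sqf_apply]; tauto
        refine ⟨?_, ?_⟩
        · rw [hs]; exact Finset.subset_union_right
        · rw [hs]; exact Finset.union_subset (by exact_mod_cast hv) Finset.subset_union_left
      exact ⟨_, hU, (hb _ _ (by rw [sqf_support]; exact C.2.1) (hUQ C _ hU).1).symm⟩
    · rintro ⟨u, hu, rfl⟩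
      have hle : sqf C.1 ≤ u := by
        intro i
        rw [sqf_apply]
        split_ifs with h
        · have := hu.1 h
          rw [Finsupp.mem_support_iff] at this
          omega
        · exact Nat.zero_le _
      have he : (u - sqf C.1) + sqf C.1 = u := tsub_add_cancel_of_le hle
      refine ⟨u - sqf C.1, ?_, ?_⟩
      · intro i hi
        have : i ∈ u.support := by
          simp only [Finset.mem_coe, Finsupp.mem_support_iff, Finsupp.tsub_apply] at hi ⊢
          omega
        exact hu.2 this
      · rw [hb _ _ (by rw [sqf_support]; exact C.2.1) (by rw [he]; exact (hUQ C u hu).1), he]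
  let e := Fintype.equivFin B
  let w : Fin (Fintype.card B) → M := fun i => b (sqf (e.symm i).1)
  let A : Fin (Fintype.card B) → Finset σ := fun i => (e.symm i).1 ∪ fr (e.symm i).1
  have hsp' : ∀ i, stanleySpace K σ M (w i) (A i) = Submodule.span K (b '' U (e.symm i)) :=
    fun i => hspace _
  have hdec : IsStanleyDecomp K σ M w A := by
    refine ⟨?_, ?_, ?_⟩
    · intro i f hf h0
      set C := e.symm i with hC
      have hmem : ∀ v ∈ f.support, v + sqf C.1 ∈ {u | Q u.support} := by
        intro v hv
        apply hUsub C
        have hs : (v + sqf C.1).support = v.support ∪ C.1 := by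
          ext i; simp [sqf_apply]; tauto
        refine ⟨?_, ?_⟩
        · rw [hs]; exact Finset.subset_union_right
        · rw [hs]
          refine Finset.union_subset ?_ Finset.subset_union_left
          intro x hx
          exact hf (Finset.mem_coe.2 ((mem_vars_iff_mem_support x).2 ⟨v, hv, hx⟩))
      have hsum : f • w i = ∑ v ∈ f.support, coeff v f • b (v + sqf C.1) := by
        conv_lhs => rw [f.as_sum]
        rw [Finset.sum_smul]
        refine Finset.sum_congr rfl fun v hv => ?_
        rw [← hb _ _ (by rw [sqf_support]; exact C.2.1) (hmem v hv), ← smul_assoc]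
        simp [smul_monomial, w, hC]
      rw [hsum] at h0
      have hli2 : LinearIndepOn K (fun v => b (v + sqf C.1)) (f.support : Set (σ →₀ ℕ)) := by
        have : LinearIndepOn K b ((fun v => v + sqf C.1) '' (f.support : Set (σ →₀ ℕ))) :=
          hli.mono (by rintro _ ⟨v, hv, rfl⟩; exact hmem v hv)
        exact this.comp_of_image (add_left_injective _).injOn
      have hz := linearIndepOn_finset_iff.1 hli2 (fun v => coeff v f) h0
      ext v
      by_cases hv : v ∈ f.support
      · simpa using hz v hv
      · simpa using hv
    · intro i
      simp only [hsp']
      have : (⨆ j, ⨆ (_ : j ≠ i), Submodule.span K (b '' U (e.symm j)))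
          = Submodule.span K (b '' (⋃ j, ⋃ (_ : j ≠ i), U (e.symm j))) := by
        simp only [Set.image_iUnion, Submodule.span_iUnion]
      rw [this]
      have hs : U (e.symm i) ⊆ {u | Q u.support} := hUsub _
      have ht : (⋃ j, ⋃ (_ : j ≠ i), U (e.symm j)) ⊆ {u | Q u.support} :=
        Set.iUnion₂_subset fun j _ => hUsub _
      have hdj : Disjoint (U (e.symm i)) (⋃ j, ⋃ (_ : j ≠ i), U (e.symm j)) := by
        rw [Set.disjoint_left]
        intro u hu hu'
        simp only [Set.mem_iUnion] at hu'
        obtain ⟨j, hj, hu'⟩ := hu'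
        exact hj (e.symm.injective (hUdisj _ _ u hu' hu))
      have := (linearIndepOn_union_iff hdj).1 (hli.mono (Set.union_subset hs ht))
      exact this.2.2
    · simp only [hsp']
      rw [← Submodule.span_iUnion, ← Set.image_iUnion, eq_top_iff]
      refine hsp.trans (Submodule.span_mono (Set.image_mono ?_))
      intro u hu
      have hu' : Q u.support := hu
      obtain ⟨h1, h2⟩ := base _ hu'
      let C : B := ⟨u.support \ fr u.support, h1, by rw [h2]; exact Finset.sdiff_disjoint⟩
      refine Set.mem_iUnion.2 ⟨e C, ?_⟩
      rw [Equiv.symm_apply_apply]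
      refine ⟨Finset.sdiff_subset, ?_⟩
      change u.support ⊆ (u.support \ fr u.support) ∪ fr (u.support \ fr u.support)
      rw [h2]
      intro x hx
      simp only [Finset.mem_union, Finset.mem_sdiff]
      tauto
  obtain ⟨F, hF⟩ := hex
  obtain ⟨h1, h2⟩ := base F hF
  let C : B := ⟨F \ fr F, h1, by rw [h2]; exact Finset.sdiff_disjoint⟩
  refine le_trans ?_ (le_csSup sdepthSet_bddAbove ⟨_, w, A, hdec, rfl⟩)
  obtain ⟨i, hi⟩ := Nat.sInf_mem (s := Set.range fun i => (A i).card) ⟨_, e C, rfl⟩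
  rw [← hi]
  exact hd _ (e.symm i).2.1

end Aux

section EdgeIdeal

variable (K : Type) [Field K] {V : Type} (Adj : V → V → Prop)

/-- The set `F` contains an edge. -/
def Dep (F : Finset V) : Prop := ∃ a b, Adj a b ∧ a ∈ F ∧ b ∈ F

variable {Adj} in
lemma mem_edgeIdeal (hne : ∀ a b, Adj a b → a ≠ b) (p : MvPolynomial V K) :
    p ∈ edgeIdeal K Adj ↔ ∀ u ∈ p.support, Dep Adj u.support := by
  classical
  have : { p : MvPolynomial V K | ∃ a b : V, Adj a b ∧ p = X a * X b } =
      (fun s => monomial s (1 : K)) ''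
        {s | ∃ a b, Adj a b ∧ s = Finsupp.single a 1 + Finsupp.single b 1} := by
    ext p
    constructor
    · rintro ⟨a, b, h, rfl⟩
      exact ⟨_, ⟨a, b, h, rfl⟩, by simp [X, monomial_mul]⟩
    · rintro ⟨_, ⟨a, b, h, rfl⟩, rfl⟩
      exact ⟨a, b, h, by simp [X, monomial_mul]⟩
  rw [edgeIdeal, this, mem_ideal_span_monomial_image]
  refine forall₂_congr fun u _ => ?_
  constructor
  · rintro ⟨_, ⟨a, b, h, rfl⟩, hle⟩
    refine ⟨a, b, h, ?_, ?_⟩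
    · have := hle a
      simp at this ⊢
      omega
    · have := hle b
      simp at this ⊢
      omega
  · rintro ⟨a, b, h, ha, hb⟩
    refine ⟨_, ⟨a, b, h, rfl⟩, ?_⟩
    intro c
    have := hne a b h
    simp only [Finsupp.mem_support_iff] at ha hb
    simp only [Finsupp.add_apply, Finsupp.single_apply]
    split_ifs <;> grind

variable {Adj} in
lemma monomial_mem_edgeIdeal (hne : ∀ a b, Adj a b → a ≠ b) (u : V →₀ ℕ) :
    monomial u (1 : K) ∈ edgeIdeal K Adj ↔ Dep Adj u.support := by
  classical
  rw [mem_edgeIdeal K hne]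
  simp [support_monomial]

variable {Adj} in
theorem sdepth_quot_ge [Fintype V] [DecidableEq V] (hne : ∀ a b, Adj a b → a ≠ b)
    (fr : Finset V → Finset V) (d : ℕ)
    (hfr : ∀ F F', ¬ Dep Adj F → F \ fr F ⊆ F' → F' ⊆ F ∪ fr F →
      ¬ Dep Adj F' ∧ fr F' = fr F)
    (hd : ∀ F, ¬ Dep Adj F → d ≤ (F ∪ fr F).card) :
    d ≤ sdepth K V (MvPolynomial V K ⧸ edgeIdeal K Adj) := by
  classical
  refine sdepth_ge (fun F => ¬ Dep Adj F) fr
    (fun u => Ideal.Quotient.mk (edgeIdeal K Adj) (monomial u 1)) d ?_ ?_ ?_ hfr hd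
    ⟨∅, by simp [Dep]⟩
  · intro u v _ _
    rw [← Ideal.Quotient.mk_eq_mk, ← Ideal.Quotient.mk_eq_mk, ← Submodule.Quotient.mk_smul,
      smul_eq_mul, monomial_mul, one_mul]
  · rw [linearIndepOn_iff']
    intro s g hs h0 u hu
    have h1 : (∑ i ∈ s, monomial i (g i)) ∈ edgeIdeal K Adj := by
      rw [← Ideal.Quotient.eq_zero_iff_mem, map_sum, ← h0]
      refine Finset.sum_congr rfl fun i _ => ?_
      rw [← Ideal.Quotient.mk_eq_mk, ← Ideal.Quotient.mk_eq_mk, ← Submodule.Quotient.mk_smul,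
        smul_monomial, smul_eq_mul, mul_one]
    rw [mem_edgeIdeal K hne] at h1
    by_contra hg
    refine hs hu (h1 u ?_)
    rw [mem_support_iff, coeff_sum]
    simpa [coeff_monomial, hu] using hg
  · rintro x -
    obtain ⟨p, rfl⟩ := Ideal.Quotient.mk_surjective x
    rw [p.as_sum, map_sum]
    refine Submodule.sum_mem _ fun u _ => ?_
    have : Ideal.Quotient.mk (edgeIdeal K Adj) (monomial u (coeff u p)) =
        coeff u p • Ideal.Quotient.mk (edgeIdeal K Adj) (monomial u 1) := by
      rw [← Ideal.Quotient.mk_eq_mk, ← Ideal.Quotient.mk_eq_mk, ← Submodule.Quotient.mk_smul,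
        smul_monomial, smul_eq_mul, mul_one]
    rw [this]
    refine Submodule.smul_mem _ _ ?_
    by_cases h : Dep Adj u.support
    · rw [Ideal.Quotient.eq_zero_iff_mem.2 ((monomial_mem_edgeIdeal K hne u).2 h)]
      exact Submodule.zero_mem _
    · exact Submodule.subset_span ⟨u, h, rfl⟩

variable {Adj} in
theorem sdepth_ideal_ge [Fintype V] [DecidableEq V] (hne : ∀ a b, Adj a b → a ≠ b)
    (fr : Finset V → Finset V) (d : ℕ)
    (hfr : ∀ F F', Dep Adj F → F \ fr F ⊆ F' → F' ⊆ F ∪ fr F →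
      Dep Adj F' ∧ fr F' = fr F)
    (hd : ∀ F, Dep Adj F → d ≤ (F ∪ fr F).card) (hex : ∃ F, Dep Adj F) :
    d ≤ sdepth K V (edgeIdeal K Adj) := by
  classical
  let b : (V →₀ ℕ) → edgeIdeal K Adj := fun u =>
    if h : Dep Adj u.support then ⟨monomial u 1, (monomial_mem_edgeIdeal K hne u).2 h⟩ else 0
  have hbv : ∀ u : V →₀ ℕ, Dep Adj u.support → (b u : MvPolynomial V K) = monomial u 1 := by
    intro u hu
    simp [b, hu]
  refine sdepth_ge (Dep Adj) fr b d ?_ ?_ ?_ hfr hd hex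
  · intro u v hu hv
    apply Subtype.ext
    rw [Submodule.coe_smul, hbv u hu, hbv _ hv, smul_eq_mul, monomial_mul, one_mul]
  · rw [linearIndepOn_iff']
    intro s g hs h0 u hu
    have h1 : (∑ i ∈ s, monomial i (g i)) = (0 : MvPolynomial V K) := by
      have := congrArg (Subtype.val) h0
      rw [AddSubmonoidClass.coe_finsetSum] at this
      refine Eq.trans ?_ this
      refine Finset.sum_congr rfl fun i hi => ?_
      rw [Submodule.coe_smul_of_tower, hbv i (hs hi), smul_monomial, smul_eq_mul, mul_one]
    have h2 := congrArg (coeff u) h1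
    rw [coeff_sum] at h2
    simpa [coeff_monomial, hu] using h2
  · rintro ⟨p, hp⟩ -
    have hp' := (mem_edgeIdeal K hne p).1 hp
    have : (⟨p, hp⟩ : edgeIdeal K Adj) = ∑ u ∈ p.support, coeff u p • b u := by
      apply Subtype.ext
      rw [AddSubmonoidClass.coe_finsetSum]
      refine p.as_sum.trans ?_
      refine Finset.sum_congr rfl fun i hi => ?_
      rw [Submodule.coe_smul_of_tower, hbv i (hp' i hi), smul_monomial, smul_eq_mul, mul_one]
    rw [this]
    exact Submodule.sum_mem _ fun u hu =>
      Submodule.smul_mem _ _ (Submodule.subset_span ⟨u, hp' u hu, rfl⟩)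

variable {Adj} in
/-- Upper bound: a maximal independent set bounds the Stanley depth of the quotient. -/
theorem sdepth_quot_le [Fintype V] [DecidableEq V] (hne : ∀ a b, Adj a b → a ≠ b)
    (D : Finset V) (hD : ¬ Dep Adj D) (hdom : ∀ y, y ∉ D → ∃ x ∈ D, Adj x y) :
    sdepth K V (MvPolynomial V K ⧸ edgeIdeal K Adj) ≤ D.card := by
  classical
  apply csSup_le'
  rintro d ⟨r, w, A, ⟨hfree, -, htop⟩, rfl⟩
  by_contra! hlt
  have hcard : ∀ i, D.card < (A i).card := fun i => hlt.trans_le (Nat.sInf_le ⟨i, rfl⟩)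
  have hex : ∀ i, ∃ x ∈ D, x ∉ A i := by
    intro i
    by_contra! hsub
    obtain ⟨y, hy, hyD⟩ := Finset.exists_mem_notMem_of_card_lt_card (hcard i)
    obtain ⟨x, hx, hxy⟩ := hdom y hyD
    have h0 : (X x * X y : MvPolynomial V K) • w i = 0 := by
      obtain ⟨g, hg⟩ := Ideal.Quotient.mk_surjective (w i)
      rw [← hg, ← Ideal.Quotient.mk_eq_mk, ← Submodule.Quotient.mk_smul,
        Submodule.Quotient.mk_eq_zero, smul_eq_mul]
      exact Ideal.mul_mem_right _ _ (Ideal.subset_span ⟨x, y, hxy, rfl⟩)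
    have := hfree i _ ?_ h0
    · exact mul_ne_zero (X_ne_zero x) (X_ne_zero y) this
    · intro z hz
      have := vars_mul (X x : MvPolynomial V K) (X y) (Finset.mem_coe.1 hz)
      simp only [vars_X, Finset.mem_union, Finset.mem_singleton] at this
      rcases this with rfl | rfl
      · exact hsub _ hx
      · exact hy
  choose g hg using fun i => Ideal.Quotient.mk_surjective (w i)
  obtain ⟨N, hN0, hN⟩ : ∃ N : ℕ, 0 < N ∧ ∀ i, (g i).totalDegree < N :=
    ⟨(∑ i, (g i).totalDegree) + 1, by omega, fun i => Nat.lt_succ_of_le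
      (Finset.single_le_sum (f := fun i => (g i).totalDegree) (fun _ _ => Nat.zero_le _)
        (Finset.mem_univ i))⟩
  let m : V →₀ ℕ := N • sqf D
  have hmapp : ∀ x, m x = if x ∈ D then N else 0 := by
    intro x; simp [m, sqf_apply]
  have hms : m.support = D := by
    ext x; simp [hmapp]; omega
  let L : MvPolynomial V K →ₗ[K] K := lcoeff K m
  have hL : ∀ p, L p = coeff m p := fun p => rfl
  have hI : ∀ p ∈ edgeIdeal K Adj, coeff m p = 0 := by
    intro p hp
    by_contra h
    have := (mem_edgeIdeal K hne p).1 hp m (mem_support_iff.2 h)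
    rw [hms] at this
    exact hD this
  let W : Submodule K (MvPolynomial V K ⧸ edgeIdeal K Adj) :=
    { carrier := {x | ∀ p, Ideal.Quotient.mk (edgeIdeal K Adj) p = x → coeff m p = 0}
      add_mem' := by
        intro x y hx hy p hp
        obtain ⟨q, rfl⟩ := Ideal.Quotient.mk_surjective x
        have := hy (p - q) (by rw [map_sub, hp]; abel)
        rw [coeff_sub, hx q rfl, sub_zero] at this
        exact this
      zero_mem' := by
        intro p hp
        exact hI p (Ideal.Quotient.eq_zero_iff_mem.1 hp)
      smul_mem' := by
        intro c x hx p hp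
        obtain ⟨q, rfl⟩ := Ideal.Quotient.mk_surjective x
        have h1 : p - c • q ∈ edgeIdeal K Adj := by
          rw [← Ideal.Quotient.eq_zero_iff_mem, map_sub, hp, ← Ideal.Quotient.mk_eq_mk,
            ← Ideal.Quotient.mk_eq_mk, ← Submodule.Quotient.mk_smul, sub_self]
        have h2 := hI _ h1
        rw [coeff_sub, coeff_smul, hx q rfl, smul_zero, sub_zero] at h2
        exact h2 }
  have hle : (⨆ i, stanleySpace K V (MvPolynomial V K ⧸ edgeIdeal K Adj) (w i) (A i)) ≤ W := by
    refine iSup_le fun i => Submodule.span_le.2 ?_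
    rintro _ ⟨u, hu, rfl⟩ p hp
    have h1 : p - monomial u 1 * g i ∈ edgeIdeal K Adj := by
      rw [← Ideal.Quotient.eq_zero_iff_mem, map_sub, hp, ← hg i, ← Ideal.Quotient.mk_eq_mk,
        ← Ideal.Quotient.mk_eq_mk, ← Submodule.Quotient.mk_smul, smul_eq_mul, sub_self]
    have h2 := hI _ h1
    rw [coeff_sub, sub_eq_zero] at h2
    rw [h2, coeff_monomial_mul']
    split_ifs with hum
    · rw [one_mul]
      by_contra hc
      obtain ⟨x, hxD, hxA⟩ := hex i
      have hux : u x = 0 := by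
        by_contra h
        exact hxA (hu (Finset.mem_coe.2 (Finsupp.mem_support_iff.2 h)))
      have h3 := le_totalDegree (mem_support_iff.2 hc)
      have h4 : (m - u) x = N := by simp [hmapp, hxD, hux]
      have h5 : (m - u) x ≤ (m - u).sum fun _ e => e := by
        rw [Finsupp.sum_fintype _ _ (fun _ => rfl)]
        exact Finset.single_le_sum (f := fun y => (m - u) y) (fun _ _ => Nat.zero_le _)
          (Finset.mem_univ x)
      have := hN i
      omega
    · rfl
  rw [htop] at hle
  have := hle (Submodule.mem_top (x := Ideal.Quotient.mk (edgeIdeal K Adj) (monomial m 1)))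
    (monomial m 1) rfl
  simp at this

end EdgeIdeal

section Comb

variable {n : ℕ}

lemma pAdj_iff (a b : Fin n × Fin 3) : pAdj n 3 a b ↔
    a ≠ b ∧ ((a.1 : ℕ) ≤ b.1 + 1 ∧ (b.1 : ℕ) ≤ a.1 + 1) ∧
      ((a.2 : ℕ) ≤ b.2 + 1 ∧ (b.2 : ℕ) ≤ a.2 + 1) := by
  unfold pAdj
  rw [abs_le, abs_le]
  constructor
  · rintro ⟨h, h1, h2⟩; exact ⟨h, by omega, by omega⟩
  · rintro ⟨h, h1, h2⟩; exact ⟨h, by omega, by omega⟩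

lemma pAdj_symm {a b : Fin n × Fin 3} (h : pAdj n 3 a b) : pAdj n 3 b a := by
  rw [pAdj_iff] at *
  exact ⟨h.1.symm, h.2.1.symm, h.2.2.symm⟩

lemma vert_ext {a b : Fin n × Fin 3} (h1 : (a.1 : ℕ) = b.1) (h2 : a.2 = b.2) : a = b :=
  Prod.ext (Fin.ext h1) h2

/-- Not adjacent when in column `0`, rows congruent mod `3`. -/
lemma not_pAdj_of {a b : Fin n × Fin 3} (ha : a.2 = 0) (hb : b.2 = 0)
    (h : (a.1 : ℕ) % 3 = b.1 % 3) : ¬ pAdj n 3 a b := by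
  rw [pAdj_iff]
  rintro ⟨h1, h2, -⟩
  exact h1 (vert_ext (by omega) (ha.trans hb.symm))

open Classical in
/-- Free vertices for the quotient. -/
noncomputable def frQ (n : ℕ) (F : Finset (Fin n × Fin 3)) : Finset (Fin n × Fin 3) :=
  Finset.univ.filter fun p => (p.2 = 0 ∧ (p.1 : ℕ) % 3 = 0) ∧ ∀ q ∈ F, ¬ pAdj n 3 p q

lemma mem_frQ {F : Finset (Fin n × Fin 3)} {p} : p ∈ frQ n F ↔
    (p.2 = 0 ∧ (p.1 : ℕ) % 3 = 0) ∧ ∀ q ∈ F, ¬ pAdj n 3 p q := by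
  simp [frQ]

lemma between {V : Type} [DecidableEq V] {F F' T : Finset V} (h1 : F \ T ⊆ F')
    (h2 : F' ⊆ F ∪ T) {x : V} (hx : x ∉ T) : x ∈ F' ↔ x ∈ F := by
  have a := @h1 x
  have b := @h2 x
  simp only [Finset.mem_sdiff, Finset.mem_union] at a b
  tauto

lemma quot_lower (K : Type) [Field K] (n : ℕ) :
    (n + 2) / 3 ≤ sdepth K (Fin n × Fin 3)
      (MvPolynomial (Fin n × Fin 3) K ⧸ edgeIdeal K (pAdj n 3)) := by
  classical
  refine sdepth_quot_ge K (fun a b h => h.1) (frQ n) _ ?_ ?_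
  · intro F F' hF h1 h2
    refine ⟨?_, ?_⟩
    · rintro ⟨a, b, hab, ha, hb⟩
      by_cases haT : a ∈ frQ n F <;> by_cases hbT : b ∈ frQ n F
      · rw [mem_frQ] at haT hbT
        exact not_pAdj_of haT.1.1 hbT.1.1 (by omega) hab
      · exact (mem_frQ.1 haT).2 b ((between h1 h2 hbT).1 hb) hab
      · exact (mem_frQ.1 hbT).2 a ((between h1 h2 haT).1 ha) (pAdj_symm hab)
      · exact hF ⟨a, b, hab, (between h1 h2 haT).1 ha, (between h1 h2 hbT).1 hb⟩
    · ext p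
      rw [mem_frQ, mem_frQ]
      refine and_congr_right fun hp => forall_congr' fun q => ?_
      by_cases hq : q ∈ frQ n F
      · have hq' := (mem_frQ.1 hq).1
        have := not_pAdj_of hp.1 hq'.1 (by omega)
        simp [this]
      · rw [between h1 h2 hq]
  · intro F hF
    have : Finset.range ((n + 2) / 3) ⊆
        (F ∪ frQ n F).image fun x => ((x.1 : ℕ) + 1) / 3 := by
      intro t ht
      rw [Finset.mem_range] at ht
      let p : Fin n × Fin 3 := (⟨3 * t, by omega⟩, 0)
      rw [Finset.mem_image]
      by_cases hp : ∀ q ∈ F, ¬ pAdj n 3 p q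
      · refine ⟨p, Finset.mem_union_right _ (mem_frQ.2 ⟨⟨rfl, ?_⟩, hp⟩), ?_⟩
        · simp [p]
        · simp only [p]; omega
      · push Not at hp
        obtain ⟨q, hq, hpq⟩ := hp
        refine ⟨q, Finset.mem_union_left _ hq, ?_⟩
        rw [pAdj_iff] at hpq
        have := hpq.2.1
        simp only [p] at this
        omega
    have := (Finset.card_le_card this).trans Finset.card_image_le
    simpa using this

lemma quot_upper (K : Type) [Field K] (n : ℕ) :
    sdepth K (Fin n × Fin 3)
      (MvPolynomial (Fin n × Fin 3) K ⧸ edgeIdeal K (pAdj n 3)) ≤ (n + 2) / 3 := by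
  classical
  -- centres: rows `min (3 t + 1) (n - 1)`, middle column
  let D : Finset (Fin n × Fin 3) := Finset.univ.filter fun p =>
    p.2 = 1 ∧ ((p.1 : ℕ) % 3 = 1 ∨ ((p.1 : ℕ) % 3 = 0 ∧ (p.1 : ℕ) + 1 = n))
  have hmem : ∀ p, p ∈ D ↔
      p.2 = 1 ∧ ((p.1 : ℕ) % 3 = 1 ∨ ((p.1 : ℕ) % 3 = 0 ∧ (p.1 : ℕ) + 1 = n)) := by
    intro p; simp [D]
  refine (sdepth_quot_le K (fun a b h => h.1) D ?_ ?_).trans ?_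
  · rintro ⟨a, b, hab, ha, hb⟩
    rw [hmem] at ha hb
    rw [pAdj_iff] at hab
    refine hab.1 (vert_ext ?_ (ha.1.trans hb.1.symm))
    have := a.1.2
    have := b.1.2
    omega
  · intro y hy
    have hyn := y.1.2
    have hy3 := y.2.2
    have key : ∀ (r : ℕ) (hr : r < n), (r % 3 = 1 ∨ (r % 3 = 0 ∧ r + 1 = n)) →
        r ≤ y.1 + 1 → (y.1 : ℕ) ≤ r + 1 → ∃ x ∈ D, pAdj n 3 x y := by
      intro r hr h1 h2 h3
      have hx : ((⟨r, hr⟩, 1) : Fin n × Fin 3) ∈ D := (hmem _).2 ⟨rfl, h1⟩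
      refine ⟨_, hx, (pAdj_iff _ _).2 ⟨?_, ⟨h2, h3⟩, ?_⟩⟩
      · rintro rfl; exact hy hx
      · change (1 : ℕ) ≤ _ ∧ _ ≤ 1 + 1
        omega
    have h3 : (y.1 : ℕ) % 3 = 0 ∨ (y.1 : ℕ) % 3 = 1 ∨ (y.1 : ℕ) % 3 = 2 := by omega
    rcases h3 with h | h | h
    · by_cases hl : (y.1 : ℕ) + 1 = n
      · exact key y.1 hyn (by omega) (by omega) (by omega)
      · exact key (y.1 + 1) (by omega) (by omega) (by omega) (by omega)
    · exact key y.1 hyn (by omega) (by omega) (by omega)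
    · exact key (y.1 - 1) (by omega) (by omega) (by omega) (by omega)
  · rw [← Finset.card_range ((n + 2) / 3)]
    refine Finset.card_le_card_of_injOn (fun p => (p.1 : ℕ) / 3) ?_ ?_
    · intro p _
      have := p.1.2
      simp only [Finset.coe_range, Set.mem_Iio]
      omega
    · intro p hp q hq hpq
      have hp' := (hmem p).1 hp
      have hq' := (hmem q).1 hq
      refine vert_ext ?_ (hp'.1.trans hq'.1.symm)
      have := p.1.2
      have := q.1.2
      simp only at hpq
      omega

/-- First row index at which `F` acquires an edge. -/
noncomputable def jrow (F : Finset (Fin n × Fin 3)) : ℕ :=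
  sInf {j | ∃ a b, pAdj n 3 a b ∧ a ∈ F ∧ b ∈ F ∧ (a.1 : ℕ) ≤ j ∧ (b.1 : ℕ) ≤ j}

lemma jrow_le {F : Finset (Fin n × Fin 3)} {a b} (h : pAdj n 3 a b) (ha : a ∈ F) (hb : b ∈ F)
    {j : ℕ} (h1 : (a.1 : ℕ) ≤ j) (h2 : (b.1 : ℕ) ≤ j) : jrow F ≤ j :=
  Nat.sInf_le ⟨a, b, h, ha, hb, h1, h2⟩

lemma jrow_spec {F : Finset (Fin n × Fin 3)} (hF : Dep (pAdj n 3) F) :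
    ∃ a b, pAdj n 3 a b ∧ a ∈ F ∧ b ∈ F ∧ (a.1 : ℕ) ≤ jrow F ∧ (b.1 : ℕ) ≤ jrow F ∧
      jrow F ≤ a.1 + 1 ∧ jrow F ≤ b.1 + 1 := by
  have hne : {j | ∃ a b, pAdj n 3 a b ∧ a ∈ F ∧ b ∈ F ∧ (a.1 : ℕ) ≤ j ∧ (b.1 : ℕ) ≤ j}.Nonempty := by
    obtain ⟨a, b, h, ha, hb⟩ := hF
    exact ⟨n, a, b, h, ha, hb, a.1.2.le, b.1.2.le⟩
  obtain ⟨a, b, h, ha, hb, h1, h2⟩ := Nat.sInf_mem hne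
  have h3 : jrow F ≤ max (a.1 : ℕ) b.1 := jrow_le h ha hb (le_max_left _ _) (le_max_right _ _)
  have h4 := ((pAdj_iff a b).1 h).2.1
  exact ⟨a, b, h, ha, hb, h1, h2, by omega, by omega⟩

open Classical in
/-- Free vertices for the ideal. -/
noncomputable def frI (n : ℕ) (F : Finset (Fin n × Fin 3)) : Finset (Fin n × Fin 3) :=
  Finset.univ.filter fun p => p.2 = 0 ∧ (jrow F < p.1 ∨
    (((p.1 : ℕ) + 3 ≤ jrow F ∧ (p.1 : ℕ) % 3 = jrow F % 3) ∧ ∀ q ∈ F, ¬ pAdj n 3 p q))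

lemma mem_frI {F : Finset (Fin n × Fin 3)} {p} : p ∈ frI n F ↔
    p.2 = 0 ∧ (jrow F < p.1 ∨
    (((p.1 : ℕ) + 3 ≤ jrow F ∧ (p.1 : ℕ) % 3 = jrow F % 3) ∧ ∀ q ∈ F, ¬ pAdj n 3 p q)) := by
  simp [frI]

lemma ideal_lower (K : Type) [Field K] (n : ℕ) (hn : 1 ≤ n) :
    (n + 2) / 3 + 1 ≤ sdepth K (Fin n × Fin 3) (edgeIdeal K (pAdj n 3)) := by
  classical
  refine sdepth_ideal_ge K (fun a b h => h.1) (frI n) _ ?_ ?_ ?_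
  · intro F F' hF h1 h2
    obtain ⟨a, b, hab, ha, hb, ha1, hb1, ha2, hb2⟩ := jrow_spec hF
    have hmid : ∀ x : Fin n × Fin 3, (x.1 : ℕ) ≤ jrow F → jrow F ≤ x.1 + 1 → x ∉ frI n F := by
      intro x hx1 hx2 hx
      rw [mem_frI] at hx
      omega
    have ha' := (between h1 h2 (hmid a ha1 ha2)).2 ha
    have hb' := (between h1 h2 (hmid b hb1 hb2)).2 hb
    have hF' : Dep (pAdj n 3) F' := ⟨a, b, hab, ha', hb'⟩
    have hj : jrow F' = jrow F := by
      apply le_antisymm (jrow_le hab ha' hb' ha1 hb1)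
      by_contra! hlt
      obtain ⟨c, d, hcd, hc, hd, hc1, hd1, -, -⟩ := jrow_spec hF'
      by_cases hcT : c ∈ frI n F <;> by_cases hdT : d ∈ frI n F
      · rw [mem_frI] at hcT hdT
        refine not_pAdj_of hcT.1 hdT.1 ?_ hcd
        rcases hcT.2 with h | h <;> rcases hdT.2 with h' | h' <;> omega
      · rcases (mem_frI.1 hcT).2 with h | h
        · omega
        · exact h.2 d ((between h1 h2 hdT).1 hd) hcd
      · rcases (mem_frI.1 hdT).2 with h | h
        · omega
        · exact h.2 c ((between h1 h2 hcT).1 hc) (pAdj_symm hcd)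
      · have := jrow_le hcd ((between h1 h2 hcT).1 hc) ((between h1 h2 hdT).1 hd) hc1 hd1
        omega
    refine ⟨hF', ?_⟩
    ext p
    rw [mem_frI, mem_frI, hj]
    refine and_congr_right fun hp0 => or_congr_right (and_congr_right fun hp =>
      forall_congr' fun q => ?_)
    by_cases hq : q ∈ frI n F
    · have hnot : ¬ pAdj n 3 p q := by
        intro hpq
        have h4 := ((pAdj_iff p q).1 hpq).2.1
        have hq' := mem_frI.1 hq
        refine not_pAdj_of hp0 hq'.1 ?_ hpq
        rcases hq'.2 with h | h <;> omega
      simp [hnot]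
    · rw [between h1 h2 hq]
  · intro F hF
    obtain ⟨a, b, hab, ha, hb, ha1, hb1, ha2, hb2⟩ := jrow_spec hF
    set j := jrow F with hjdef
    have hjn : j < n := by
      have := a.1.2
      have := b.1.2
      have : j ≤ max (a.1 : ℕ) b.1 := jrow_le hab ha hb (le_max_left _ _) (le_max_right _ _)
      omega
    set G := F ∪ frI n F with hG
    let φ : Fin n × Fin 3 → ℕ := fun x =>
      if (x.1 : ℕ) ≤ j then (j - 2 - x.1) / 3 else x.1
    have hsub : Finset.range (j / 3) ∪ Finset.Ioo j n ⊆ ((G.erase a).erase b).image φ := by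
      have hfin : ∀ x ∈ G, ((x.1 : ℕ) + 2 ≤ j ∨ j < x.1) → x ∈ (G.erase a).erase b := by
        intro x hx h
        rw [Finset.mem_erase, Finset.mem_erase]
        refine ⟨?_, ?_, hx⟩
        · rintro rfl; omega
        · rintro rfl; omega
      intro t ht
      rw [Finset.mem_union, Finset.mem_range, Finset.mem_Ioo] at ht
      rw [Finset.mem_image]
      rcases ht with ht | ht
      · let p : Fin n × Fin 3 := (⟨j - 3 - 3 * t, by omega⟩, 0)
        have hp1 : (p.1 : ℕ) = j - 3 - 3 * t := rfl
        by_cases hp : ∀ q ∈ F, ¬ pAdj n 3 p q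
        · refine ⟨p, hfin p (Finset.mem_union_right _ (mem_frI.2 ⟨rfl, Or.inr ⟨?_, hp⟩⟩)) ?_, ?_⟩
          · rw [hp1, ← hjdef]; omega
          · left; rw [hp1]; omega
          · simp only [φ]
            rw [if_pos (by omega)]
            omega
        · push Not at hp
          obtain ⟨q, hq, hpq⟩ := hp
          have h4 := ((pAdj_iff p q).1 hpq).2.1
          refine ⟨q, hfin q (Finset.mem_union_left _ hq) (by omega), ?_⟩
          simp only [φ]
          rw [if_pos (by omega)]
          omega
      · let p : Fin n × Fin 3 := (⟨t, ht.2⟩, 0)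
        have hp1 : (p.1 : ℕ) = t := rfl
        refine ⟨p, hfin p (Finset.mem_union_right _ (mem_frI.2 ⟨rfl, Or.inl ?_⟩)) (by omega), ?_⟩
        · rw [hp1]; exact ht.1
        · simp only [φ]
          rw [if_neg (by omega)]
    have hc := (Finset.card_le_card hsub).trans Finset.card_image_le
    have haG : a ∈ G := Finset.mem_union_left _ ha
    have hbG : b ∈ G.erase a :=
      Finset.mem_erase.2 ⟨hab.1.symm, Finset.mem_union_left _ hb⟩
    have hc1 := Finset.card_erase_add_one haG
    have hc2 := Finset.card_erase_add_one hbG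
    rw [Finset.card_union_of_disjoint, Finset.card_range, Nat.card_Ioo] at hc
    · omega
    · rw [Finset.disjoint_left]
      intro t h1 h2
      rw [Finset.mem_range] at h1
      rw [Finset.mem_Ioo] at h2
      omega
  · refine ⟨Finset.univ, (⟨0, hn⟩, 0), (⟨0, hn⟩, 1), ?_, Finset.mem_univ _, Finset.mem_univ _⟩
    rw [pAdj_iff]
    simp

end Comb

/-- For every integer `n ≥ 1`,
`sdepth(I(P_{n,3})) > sdepth(S_{n,3}/I(P_{n,3})) = ⌈n/3⌉`. -/
theorem sdepth_edgeIdeal_P_n_3_gt (K : Type) [Field K] (n : ℕ) (hn : 1 ≤ n) :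
    sdepth K (Fin n × Fin 3) (edgeIdeal K (pAdj n 3)) >
      sdepth K (Fin n × Fin 3)
        (MvPolynomial (Fin n × Fin 3) K ⧸ edgeIdeal K (pAdj n 3)) ∧
    sdepth K (Fin n × Fin 3)
        (MvPolynomial (Fin n × Fin 3) K ⧸ edgeIdeal K (pAdj n 3)) = (n + 2) / 3 := by
  have h : sdepth K (Fin n × Fin 3)
        (MvPolynomial (Fin n × Fin 3) K ⧸ edgeIdeal K (pAdj n 3)) = (n + 2) / 3 :=
    le_antisymm (quot_upper K n) (quot_lower K n)
  refine ⟨?_, h⟩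
  rw [h]
  exact ideal_lower K n hn
end

section
/- Let n ≥ 6. If n ≡ 0 (mod 3), then sdepth(S◊_{n,3}/I(C◊_{n,3})) = ⌈(n−2)/3⌉; otherwise ⌈(n−2)/3⌉ ≤ sdepth(S◊_{n,3}/I(C◊_{n,3})) ≤ ⌈n/3⌉. -/
open MvPolynomial

/-- The vertex set of `C◊_{n,3}`: the vertices `(i,j)` of `Cₙ ⊠ P₃` (0-indexed) other than
the eight deleted ones, i.e. those with `j = 2` (the `z`-row) or `2 ≤ i ≤ n - 3`. -/
def diamondVert (n : ℕ) : Type :=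
  {v : Fin n × Fin 3 // (v.2 : ℕ) = 2 ∨ (2 ≤ (v.1 : ℕ) ∧ (v.1 : ℕ) + 3 ≤ n)}

section Helpers

variable {K : Type} [Field K] {V : Type} (Adj : V → V → Prop)

/-- `s` is an independent set for `Adj`. -/
def Indep (s : Finset V) : Prop := ∀ a ∈ s, ∀ b ∈ s, ¬ Adj a b

theorem Indep.mono {Adj : V → V → Prop} {s t : Finset V} (h : Indep Adj t) (hs : s ⊆ t) :
    Indep Adj s := fun a ha b hb => h a (hs ha) b (hs hb)

theorem coeff_edgeIdeal {p : MvPolynomial V K} (hp : p ∈ edgeIdeal K Adj) :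
    ∀ e : V →₀ ℕ, Indep Adj e.support → coeff e p = 0 := by
  classical
  unfold edgeIdeal at hp
  induction hp using Submodule.span_induction with
  | mem x hx =>
    obtain ⟨a, b, hab, rfl⟩ := hx
    intro e he
    have : (X a * X b : MvPolynomial V K)
        = monomial (Finsupp.single a 1 + Finsupp.single b 1) 1 := by
      simp [X, monomial_mul]
    rw [this, coeff_monomial, if_neg]
    rintro rfl
    refine he a ?_ b ?_ hab <;> simp
  | zero => intro e _; simp
  | add x y _ _ hx hy => intro e he; simp [hx e he, hy e he]
  | smul a x _ hx =>
    intro e he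
    rw [smul_eq_mul, coeff_mul]
    refine Finset.sum_eq_zero fun q hq => ?_
    rw [hx q.2, mul_zero]
    refine he.mono ?_
    replace hq := Finset.HasAntidiagonal.mem_antidiagonal.mp hq
    intro v hv
    rw [Finsupp.mem_support_iff] at hv ⊢
    rw [← hq, Finsupp.add_apply]
    omega

theorem monomial_mem_edgeIdeal_s12 (hirr : ∀ a, ¬ Adj a a) (e : V →₀ ℕ) (c : K)
    (he : ¬ Indep Adj e.support) : monomial e c ∈ edgeIdeal K Adj := by
  classical
  unfold Indep at he
  push Not at he
  obtain ⟨a, ha, b, hb, hab⟩ := he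
  have hne : a ≠ b := fun h => hirr a (h ▸ hab)
  rw [Finsupp.mem_support_iff] at ha hb
  have hle : Finsupp.single a 1 + Finsupp.single b 1 ≤ e := by
    intro v
    simp only [Finsupp.add_apply, Finsupp.single_apply]
    split_ifs with h1 h2 h2
    · exact absurd (h1.trans h2.symm) hne
    · subst h1; omega
    · subst h2; omega
    · omega
  have : monomial e c = monomial (e - (Finsupp.single a 1 + Finsupp.single b 1)) c
      * (X a * X b : MvPolynomial V K) := by
    simp only [X, monomial_mul, mul_one]
    rw [tsub_add_cancel_of_le hle]
  rw [this]
  exact Ideal.mul_mem_left _ _ (Ideal.subset_span ⟨a, b, hab, rfl⟩)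

theorem mem_edgeIdeal_of_coeff (hirr : ∀ a, ¬ Adj a a) (p : MvPolynomial V K)
    (h : ∀ e : V →₀ ℕ, Indep Adj e.support → coeff e p = 0) : p ∈ edgeIdeal K Adj := by
  rw [p.as_sum]
  refine Ideal.sum_mem _ fun e he => monomial_mem_edgeIdeal_s12 Adj hirr e _ fun hi => ?_
  exact (mem_support_iff.mp he) (h e hi)

/-- Classes with vanishing coefficient at `e`. -/
noncomputable def coeffKer (K : Type) [Field K] {V : Type} (Adj : V → V → Prop) (e : V →₀ ℕ) :
    Submodule K (MvPolynomial V K ⧸ edgeIdeal K Adj) :=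
  Submodule.map (Ideal.Quotient.mkₐ K (edgeIdeal K Adj)).toLinearMap (LinearMap.ker (lcoeff K e))

theorem mk_mem_coeffKer {e : V →₀ ℕ} (he : Indep Adj e.support) (p : MvPolynomial V K) :
    Ideal.Quotient.mk (edgeIdeal K Adj) p ∈ coeffKer K Adj e ↔ coeff e p = 0 := by
  unfold coeffKer
  rw [Submodule.mem_map]
  constructor
  · rintro ⟨q, hq, hqp⟩
    have h1 : q - p ∈ edgeIdeal K Adj := (Ideal.Quotient.mk_eq_mk_iff_sub_mem _ _).mp hqp
    have h2 := coeff_edgeIdeal Adj h1 e he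
    have h3 : coeff e q = 0 := hq
    rw [coeff_sub, h3, zero_sub, neg_eq_zero] at h2
    exact h2
  · intro h
    exact ⟨p, h, rfl⟩

theorem smul_mk (f p : MvPolynomial V K) :
    f • Ideal.Quotient.mk (edgeIdeal K Adj) p = Ideal.Quotient.mk (edgeIdeal K Adj) (f * p) := rfl

theorem sdepth_upper [Finite V] (F : Finset V) (hF : Indep Adj F)
    (hdom : ∀ v, v ∉ F → ∃ u ∈ F, Adj u v) {r : ℕ}
    (w : Fin r → MvPolynomial V K ⧸ edgeIdeal K Adj) (A : Fin r → Finset V)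
    (h : IsStanleyDecomp K V (MvPolynomial V K ⧸ edgeIdeal K Adj) w A) :
    sInf (Set.range fun i => (A i).card) ≤ F.card := by
  classical
  obtain ⟨hfree, -, htop⟩ := h
  have hind : ∀ i, Indep Adj (A i) := by
    intro i a ha b hb hab
    have h1 := hfree i (X a * X b) (by
      intro v hv
      have := vars_mul _ _ hv
      simp only [vars_X, Finset.mem_union, Finset.mem_singleton] at this
      rcases this with rfl | rfl
      · exact ha
      · exact hb) (by
      obtain ⟨p, hp⟩ := Ideal.Quotient.mk_surjective (w i)
      rw [← hp, smul_mk, Ideal.Quotient.eq_zero_iff_mem]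
      exact Ideal.mul_mem_right _ _ (Ideal.subset_span ⟨a, b, hab, rfl⟩))
    rcases mul_eq_zero.mp h1 with h2 | h2 <;> exact X_ne_zero _ h2
  suffices hex : ∃ i, F ⊆ A i by
    obtain ⟨i, hi⟩ := hex
    have hsub : A i ⊆ F := by
      intro v hv
      by_contra hvF
      obtain ⟨u, hu, huv⟩ := hdom v hvF
      exact hind i u (hi hu) v hv huv
    exact (Nat.sInf_le (Set.mem_range_self i)).trans (Finset.card_le_card hsub)
  by_contra hno
  push Not at hno
  choose p hp using fun i => Ideal.Quotient.mk_surjective (w i)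
  let D := ∑ i, (p i).totalDegree
  let e : V →₀ ℕ := Finsupp.indicator F fun _ _ => D + 1
  have hev : ∀ v ∈ F, e v = D + 1 := fun v hv => Finsupp.indicator_of_mem hv _
  have hes : Indep Adj e.support := hF.mono (Finsupp.support_indicator_subset _ _)
  have hle : (⨆ i, stanleySpace K V (MvPolynomial V K ⧸ edgeIdeal K Adj) (w i) (A i))
      ≤ coeffKer K Adj e := by
    refine iSup_le fun i => Submodule.span_le.mpr ?_
    rintro _ ⟨u, hu, rfl⟩
    rw [← hp i, smul_mk, SetLike.mem_coe, mk_mem_coeffKer Adj hes, coeff_monomial_mul']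
    split_ifs with hue
    · rw [one_mul]
      obtain ⟨v, hvF, hvA⟩ := Finset.not_subset.mp (hno i)
      have huv : u v = 0 := by
        by_contra h0
        exact hvA (hu (Finsupp.mem_support_iff.mpr h0))
      by_contra hc
      have h1 := le_totalDegree (mem_support_iff.mpr hc)
      have h2 : (e - u) v ≤ (e - u).sum fun _ k => k := by
        have h3 : v ∈ (e - u).support := by
          simp [hev v hvF, huv]
        exact Finset.single_le_sum (f := fun v => (e - u) v) (fun _ _ => Nat.zero_le _) h3
      have h4 : (p i).totalDegree ≤ D :=
        Finset.single_le_sum (f := fun i => (p i).totalDegree) (fun _ _ => Nat.zero_le _)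
          (Finset.mem_univ i)
      have h5 : (e - u) v = D + 1 := by
        rw [Finsupp.tsub_apply, hev v hvF, huv]; rfl
      omega
    · rfl
  rw [htop] at hle
  have := (mk_mem_coeffKer Adj hes (monomial e (1 : K))).mp (hle trivial)
  simp at this

theorem sdepth_lower_aux [Fintype V] [DecidableEq V] (hirr : ∀ a, ¬ Adj a a)
    (hsymm : ∀ a b, Adj a b → Adj b a)
    (T : Finset V) (hT : Indep Adj T)
    (hpack : ∀ s ∈ T, ∀ t ∈ T, ∀ v, Adj s v → Adj t v → s = t) :
    ∃ r, ∃ w : Fin r → MvPolynomial V K ⧸ edgeIdeal K Adj, ∃ A : Fin r → Finset V,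
      IsStanleyDecomp K V (MvPolynomial V K ⧸ edgeIdeal K Adj) w A ∧
        T.card ≤ sInf (Set.range fun i => (A i).card) := by
  classical
  let ι := {C : Finset V // Indep Adj C ∧ Disjoint C T}
  let eqv : Fin (Fintype.card ι) ≃ ι := (Fintype.equivFin ι).symm
  let top : Finset V → Finset V := fun C => C ∪ T.filter fun t => ∀ c ∈ C, ¬ Adj t c
  let ex : Finset V → (V →₀ ℕ) := fun C => Finsupp.indicator C fun _ _ => 1
  have hex1 : ∀ C v, v ∈ C → ex C v = 1 := fun C v hv => Finsupp.indicator_of_mem hv _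
  have hex0 : ∀ C v, v ∉ C → ex C v = 0 := fun C v hv => Finsupp.indicator_of_notMem hv _
  have htopi : ∀ C, Indep Adj C → Indep Adj (top C) := by
    intro C hC a ha b hb hab
    simp only [top, Finset.mem_union, Finset.mem_filter] at ha hb
    rcases ha with ha | ha <;> rcases hb with hb | hb
    · exact hC a ha b hb hab
    · exact hb.2 a ha (hsymm _ _ hab)
    · exact ha.2 b hb hab
    · exact hT a ha.1 b hb.1 hab
  have hsupp : ∀ (C : Finset V) (u : V →₀ ℕ), u.support ⊆ top C → Disjoint C T →
      (u + ex C).support ⊆ top C ∧ (u + ex C).support \ T = C := by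
    intro C u hu hCT
    have h1 : ∀ v, v ∈ (u + ex C).support ↔ v ∈ u.support ∨ v ∈ C := by
      intro v
      simp only [Finsupp.mem_support_iff, Finsupp.add_apply]
      by_cases hv : v ∈ C
      · simp [hv, hex1 C v hv]
      · simp [hv, hex0 C v hv]
    constructor
    · intro v hv
      rcases (h1 v).mp hv with h | h
      · exact hu h
      · exact Finset.mem_union_left _ h
    · ext v
      rw [Finset.mem_sdiff, h1]
      constructor
      · rintro ⟨h | h, hvT⟩
        · have := hu h
          simp only [top, Finset.mem_union, Finset.mem_filter] at this
          tauto
        · exact h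
      · intro h
        exact ⟨Or.inr h, Finset.disjoint_left.mp hCT h⟩
  let w : Fin (Fintype.card ι) → MvPolynomial V K ⧸ edgeIdeal K Adj := fun i =>
    Ideal.Quotient.mk _ (monomial (ex (eqv i).1) 1)
  let A : Fin (Fintype.card ι) → Finset V := fun i => top (eqv i).1
  -- Stanley spaces kill all other coefficients
  have hker : ∀ i (e : V →₀ ℕ), Indep Adj e.support → e.support \ T ≠ (eqv i).1 →
      stanleySpace K V (MvPolynomial V K ⧸ edgeIdeal K Adj) (w i) (A i) ≤ coeffKer K Adj e := by
    intro i e he hne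
    refine Submodule.span_le.mpr ?_
    rintro _ ⟨u, hu, rfl⟩
    simp only [w]
    rw [smul_mk, SetLike.mem_coe, mk_mem_coeffKer Adj he, monomial_mul, coeff_monomial, if_neg]
    rintro rfl
    exact hne (hsupp _ u (by exact_mod_cast hu) (eqv i).2.2).2
  refine ⟨Fintype.card ι, w, A, ⟨?_, ?_, ?_⟩, ?_⟩
  · intro i f hf h0
    simp only [w] at h0
    rw [smul_mk, Ideal.Quotient.eq_zero_iff_mem] at h0
    ext u
    rw [coeff_zero]
    by_contra hc
    have hus : u.support ⊆ top (eqv i).1 := by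
      intro v hv
      exact hf ((mem_vars_iff_mem_support v).mpr ⟨u, mem_support_iff.mpr hc, hv⟩)
    have := coeff_edgeIdeal Adj h0 (u + ex (eqv i).1)
      ((htopi _ (eqv i).2.1).mono (hsupp _ u hus (eqv i).2.2).1)
    rw [coeff_mul_monomial, mul_one] at this
    exact hc this
  · intro i
    rw [Submodule.disjoint_def]
    intro x hx hx'
    obtain ⟨p, rfl⟩ := Ideal.Quotient.mk_surjective x
    rw [Ideal.Quotient.eq_zero_iff_mem]
    refine mem_edgeIdeal_of_coeff Adj hirr p fun e he => ?_
    rw [← mk_mem_coeffKer Adj he]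
    by_cases hei : e.support \ T = (eqv i).1
    · refine (iSup₂_le fun j hj => hker j e he ?_ :
        (⨆ j, ⨆ (_ : j ≠ i), stanleySpace K V (MvPolynomial V K ⧸ edgeIdeal K Adj) (w j) (A j))
          ≤ coeffKer K Adj e) hx'
      intro h
      exact hj (eqv.injective (Subtype.ext (h.symm.trans hei)))
    · exact hker i e he hei hx
  · rw [eq_top_iff]
    rintro x -
    obtain ⟨p, rfl⟩ := Ideal.Quotient.mk_surjective x
    induction p using MvPolynomial.induction_on' with
    | add p q hp hq => rw [map_add]; exact Submodule.add_mem _ hp hq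
    | monomial e c =>
      by_cases he : Indep Adj e.support
      · let i := eqv.symm ⟨e.support \ T, he.mono Finset.sdiff_subset, Finset.sdiff_disjoint⟩
        have hi : (eqv i).1 = e.support \ T := by simp [i]
        refine Submodule.mem_iSup_of_mem i ?_
        have hle : ex (e.support \ T) ≤ e := by
          intro v
          by_cases hv : v ∈ e.support \ T
          · rw [hex1 _ v hv]
            have := Finsupp.mem_support_iff.mp (Finset.mem_sdiff.mp hv).1
            omega
          · rw [hex0 _ v hv]; exact Nat.zero_le _
        have heq : Ideal.Quotient.mk (edgeIdeal K Adj) (monomial e c)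
            = c • ((monomial (e - ex (e.support \ T)) (1 : K) : MvPolynomial V K) • w i) := by
          simp only [w, hi]
          rw [smul_mk, monomial_mul, tsub_add_cancel_of_le hle, mul_one]
          have : (monomial e c : MvPolynomial V K) = c • monomial e 1 := by
            rw [smul_monomial, smul_eq_mul, mul_one]
          rw [this]
          rfl
        rw [heq]
        refine Submodule.smul_mem _ _ (Submodule.subset_span ⟨_, ?_, rfl⟩)
        simp only [A, hi]
        intro v hv
        have hv' : v ∈ e.support := Finsupp.support_tsub hv
        simp only [top, Finset.mem_coe, Finset.mem_union, Finset.mem_filter, Finset.mem_sdiff]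
        by_cases hvT : v ∈ T
        · exact Or.inr ⟨hvT, fun c hc => he v hv' c hc.1⟩
        · exact Or.inl ⟨hv', hvT⟩
      · rw [Ideal.Quotient.eq_zero_iff_mem.mpr (monomial_mem_edgeIdeal_s12 Adj hirr e c he)]
        exact Submodule.zero_mem _
  · have hne : (Set.range fun i => (A i).card).Nonempty :=
      ⟨_, eqv.symm ⟨∅, by intro a ha; simp at ha, Finset.disjoint_empty_left _⟩, rfl⟩
    refine le_csInf hne ?_
    rintro _ ⟨i, rfl⟩
    simp only [A]
    have hch : ∀ t, ∃ v, t ∈ T → (v ∈ top (eqv i).1 ∧ (v = t ∨ (v ∈ (eqv i).1 ∧ Adj t v))) := by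
      intro t
      by_cases hc : ∀ c ∈ (eqv i).1, ¬ Adj t c
      · exact ⟨t, fun ht => ⟨Finset.mem_union_right _ (Finset.mem_filter.mpr ⟨ht, hc⟩), Or.inl rfl⟩⟩
      · push Not at hc
        obtain ⟨c, hc, htc⟩ := hc
        exact ⟨c, fun _ => ⟨Finset.mem_union_left _ hc, Or.inr ⟨hc, htc⟩⟩⟩
    choose g hg using hch
    have hdis := Finset.disjoint_left.mp (eqv i).2.2
    refine Finset.card_le_card_of_injOn g (fun t ht => (hg t ht).1) ?_
    intro s hs t ht hst
    rcases (hg s hs).2 with h1 | h1 <;> rcases (hg t ht).2 with h2 | h2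
    · rw [← h1, ← h2, hst]
    · exact absurd hs (h1 ▸ hst ▸ hdis h2.1)
    · exact absurd ht (h2 ▸ hst ▸ hdis h1.1)
    · exact hpack s hs t ht (g s) h1.2 (hst ▸ h2.2)

theorem cAdj_symm (n m : ℕ) (a b : Fin n × Fin m) (h : cAdj n m a b) : cAdj n m b a := by
  obtain ⟨h1, h2, h3⟩ := h
  refine ⟨h1.symm, ?_, ?_⟩
  · omega
  · rw [abs_sub_comm]; exact h3

/-- Coordinates characterisation of adjacency. -/
theorem cAdj_iff (n : ℕ) (a b : Fin n × Fin 3) :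
    cAdj n 3 a b ↔ ((a.1 : ℕ) ≠ b.1 ∨ (a.2 : ℕ) ≠ b.2) ∧
      ((a.1 : ℕ) ≤ b.1 + 1 ∧ (b.1 : ℕ) ≤ a.1 + 1 ∨ (a.1 : ℕ) + n ≤ b.1 + 1 ∨
        (b.1 : ℕ) + n ≤ a.1 + 1) ∧
      (a.2 : ℕ) ≤ b.2 + 1 ∧ (b.2 : ℕ) ≤ a.2 + 1 := by
  obtain ⟨⟨a1, ha1⟩, ⟨a2, ha2⟩⟩ := a
  obtain ⟨⟨b1, hb1⟩, ⟨b2, hb2⟩⟩ := b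
  simp only [cAdj, ne_eq, Prod.mk.injEq, Fin.mk.injEq, abs_le]
  omega

/-- The small dominating independent family. -/
def domFun (n : ℕ) (hn : 6 ≤ n) (j : Fin ((n + 2) / 3)) : diamondVert n :=
  ⟨(⟨if 3 * (j : ℕ) + 3 ≤ n then 3 * j else 3 * j - 1, by have := j.2; split_ifs <;> omega⟩,
    ⟨if (j : ℕ) = 0 ∨ 3 * (j : ℕ) + 1 = n then 2 else 1, by split_ifs <;> omega⟩), by
    have := j.2
    simp only
    split_ifs <;> omega⟩

/-- The packing family. -/
def packFun (n : ℕ) (j : Fin (n / 3)) : diamondVert n :=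
  ⟨(⟨3 * (j : ℕ), by have := j.2; omega⟩, ⟨2, by omega⟩), Or.inl rfl⟩

end Helpers

/-- Let `n ≥ 6`. If `n ≡ 0 (mod 3)` then `sdepth(S◊_{n,3}/I(C◊_{n,3})) = ⌈(n−2)/3⌉`;
otherwise `⌈(n−2)/3⌉ ≤ sdepth(S◊_{n,3}/I(C◊_{n,3})) ≤ ⌈n/3⌉`. -/
theorem sdepth_quotient_edgeIdeal_CDiamond_n_3 (K : Type) [Field K] (n : ℕ) (hn : 6 ≤ n) :
    (n % 3 = 0 →
      sdepth K (diamondVert n)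
          (MvPolynomial (diamondVert n) K ⧸
            edgeIdeal K (fun a b : diamondVert n => cAdj n 3 a.1 b.1)) = (n - 2 + 2) / 3) ∧
    (n % 3 ≠ 0 →
      (n - 2 + 2) / 3 ≤ sdepth K (diamondVert n)
          (MvPolynomial (diamondVert n) K ⧸
            edgeIdeal K (fun a b : diamondVert n => cAdj n 3 a.1 b.1)) ∧
      sdepth K (diamondVert n)
          (MvPolynomial (diamondVert n) K ⧸
            edgeIdeal K (fun a b : diamondVert n => cAdj n 3 a.1 b.1)) ≤ (n + 2) / 3) := by
  classical
  have : Fintype (diamondVert n) := by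
    unfold diamondVert
    exact Fintype.ofFinite _
  set Adj : diamondVert n → diamondVert n → Prop := fun a b => cAdj n 3 a.1 b.1 with hAdj
  have hadj : ∀ a b, Adj a b ↔ _ := fun a b => cAdj_iff n a.1 b.1
  have hup : ∀ r (w : Fin r → MvPolynomial (diamondVert n) K ⧸ edgeIdeal K Adj)
      (A : Fin r → Finset (diamondVert n)), IsStanleyDecomp K _ _ w A →
      sInf (Set.range fun i => (A i).card) ≤ (n + 2) / 3 := by
    intro r w A h
    refine (sdepth_upper Adj (Finset.univ.image (domFun n hn)) ?_ ?_ w A h).trans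
      (Finset.card_image_le.trans (by simp))
    · intro a ha b hb hab
      obtain ⟨i, -, rfl⟩ := Finset.mem_image.mp ha
      obtain ⟨j, -, rfl⟩ := Finset.mem_image.mp hb
      rw [hadj] at hab
      have hi := i.2
      have hj := j.2
      simp only [domFun] at hab
      obtain ⟨h1, h2, h3⟩ := hab
      split_ifs at h1 h2 h3 <;> omega
    · rintro ⟨⟨⟨c, hc⟩, ⟨d, hd⟩⟩, hv⟩ hnot
      simp only at hv
      suffices hs : ∃ j : Fin ((n + 2) / 3),
          Adj (domFun n hn j) ⟨(⟨c, hc⟩, ⟨d, hd⟩), hv⟩ ∨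
            domFun n hn j = ⟨(⟨c, hc⟩, ⟨d, hd⟩), hv⟩ by
        obtain ⟨j, hj | hj⟩ := hs
        · exact ⟨_, Finset.mem_image_of_mem _ (Finset.mem_univ j), hj⟩
        · exact absurd (hj ▸ Finset.mem_image_of_mem _ (Finset.mem_univ j)) hnot
      have key : ∀ j : Fin ((n + 2) / 3),
          (((domFun n hn j).1.1 : ℕ) ≤ c + 1 ∧ c ≤ (domFun n hn j).1.1 + 1 ∨
            ((domFun n hn j).1.1 : ℕ) + n ≤ c + 1 ∨ c + n ≤ (domFun n hn j).1.1 + 1) →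
          (((domFun n hn j).1.2 : ℕ) ≤ d + 1 ∧ d ≤ (domFun n hn j).1.2 + 1) →
          (Adj (domFun n hn j) ⟨(⟨c, hc⟩, ⟨d, hd⟩), hv⟩ ∨
            domFun n hn j = ⟨(⟨c, hc⟩, ⟨d, hd⟩), hv⟩) := by
        intro j h1 h2
        by_cases heq : ((domFun n hn j).1.1 : ℕ) = c ∧ ((domFun n hn j).1.2 : ℕ) = d
        · right
          exact Subtype.ext (Prod.ext (Fin.ext heq.1) (Fin.ext heq.2))
        · left
          refine (hadj _ _).mpr ⟨?_, h1, h2⟩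
          by_contra hcon
          push Not at hcon
          exact heq hcon
      by_cases hlast : c + 1 = n
      · refine ⟨⟨0, by omega⟩, key _ ?_ ?_⟩ <;> simp only [domFun] <;> split_ifs <;> omega
      · refine ⟨⟨(c + 1) / 3, by omega⟩, key _ ?_ ?_⟩ <;> simp only [domFun] <;>
          split_ifs <;> omega
  have hbdd : BddAbove { d | ∃ r, ∃ w : Fin r → MvPolynomial (diamondVert n) K ⧸ edgeIdeal K Adj,
      ∃ A : Fin r → Finset (diamondVert n), IsStanleyDecomp K _ _ w A ∧
        d = sInf (Set.range fun i => (A i).card) } := by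
    refine ⟨(n + 2) / 3, ?_⟩
    rintro d ⟨r, w, A, h, rfl⟩
    exact hup r w A h
  have hU : sdepth K (diamondVert n) (MvPolynomial (diamondVert n) K ⧸ edgeIdeal K Adj)
      ≤ (n + 2) / 3 := by
    refine csSup_le' ?_
    rintro d ⟨r, w, A, h, rfl⟩
    exact hup r w A h
  have hL : n / 3 ≤ sdepth K (diamondVert n)
      (MvPolynomial (diamondVert n) K ⧸ edgeIdeal K Adj) := by
    have hinj : Function.Injective (packFun n) := by
      intro i j hij
      have : ((packFun n i).1.1 : ℕ) = (packFun n j).1.1 := by rw [hij]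
      simp only [packFun] at this
      exact Fin.ext (by omega)
    obtain ⟨r, w, A, h, hk⟩ := sdepth_lower_aux (K := K) Adj
      (fun a h => h.1 rfl) (fun a b h => cAdj_symm n 3 _ _ h)
      (Finset.univ.image (packFun n)) (by
        intro a ha b hb hab
        obtain ⟨i, -, rfl⟩ := Finset.mem_image.mp ha
        obtain ⟨j, -, rfl⟩ := Finset.mem_image.mp hb
        rw [hadj] at hab
        have hi := i.2
        have hj := j.2
        simp only [packFun] at hab
        omega) (by
        intro a ha b hb v hav hbv
        obtain ⟨i, -, rfl⟩ := Finset.mem_image.mp ha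
        obtain ⟨j, -, rfl⟩ := Finset.mem_image.mp hb
        rw [hadj] at hav hbv
        have hi := i.2
        have hj := j.2
        have hv := v.1.1.2
        simp only [packFun] at hav hbv
        congr 1
        exact Fin.ext (by omega))
    rw [Finset.card_image_of_injective _ hinj, Finset.card_univ, Fintype.card_fin] at hk
    exact hk.trans (le_csSup hbdd ⟨r, w, A, h, rfl⟩)
  constructor
  · intro h3
    omega
  · intro h3
    exact ⟨by omega, hU⟩
end

section
/- For all integers n ≥ 2 and m ≥ 1, depth(S_{n,m}/I(P_{n,m})) ≤ ⌈n/3⌉·⌈m/3⌉ and sdepth(S_{n,m}/I(P_{n,m})) ≤ ⌈n/3⌉·⌈m/3⌉. -/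
open MvPolynomial

open scoped Pointwise in
theorem step_assoc {R : Type*} [CommRing R] [IsNoetherianRing R] (J : Ideal R) [J.IsPrime]
    {M : Type*} [AddCommGroup M] [Module R M] [Module.Finite R M] (P : Ideal R)
    (hP : IsAssociatedPrime P M) (hPJ : P ≤ J) (x : R) (hx : x ∈ J) (hreg : IsSMulRegular M x) :
    ∃ Q : Ideal R, IsAssociatedPrime Q (QuotSMulTop x M) ∧ P ≤ Q ∧ x ∈ Q ∧ Q ≤ J := by
  obtain ⟨hPp, m, hm⟩ := isAssociatedPrime_iff.mp hP
  have hm' : ∀ r, r ∈ P ↔ r • m = 0 := by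
    intro r; rw [hm]; simp [Submodule.mem_colon_singleton]
  -- the submodule of elements killed by P
  let N : Submodule R M :=
    { carrier := {y | ∀ p ∈ P, p • y = 0}
      add_mem' := by
        intro a b ha hb p hp
        rw [smul_add, ha p hp, hb p hp, add_zero]
      zero_mem' := by intro p _; simp
      smul_mem' := by
        intro c y hy p hp
        rw [smul_comm, hy p hp, smul_zero] }
  have hmN : m ∈ N := fun p hp => (hm' p).mp hp
  let f : M →ₗ[R] QuotSMulTop x M := Submodule.mkQ _
  let Nb : Submodule R (QuotSMulTop x M) := N.map f
  have hker : ∀ y : M, f y = 0 → ∃ z : M, y = x • z := by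
    intro y hy
    have : y ∈ x • (⊤ : Submodule R M) := (Submodule.Quotient.mk_eq_zero _).mp hy
    obtain ⟨z, -, hz⟩ := (Submodule.mem_smul_pointwise_iff_exists _ _ _).mp this
    exact ⟨z, hz.symm⟩
  have hann : Module.annihilator R Nb ≤ J := by
    intro s hs
    have hs' : ∀ y ∈ N, ∃ z ∈ N, s • y = x • z := by
      intro y hy
      have h1 : s • (⟨f y, Submodule.mem_map_of_mem hy⟩ : Nb) = 0 :=
        Module.mem_annihilator.mp hs _
      have h2 : f (s • y) = 0 := by
        rw [map_smul]; exact congrArg Subtype.val h1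
      obtain ⟨z, hz⟩ := hker _ h2
      refine ⟨z, ?_, hz⟩
      intro p hp
      apply hreg
      change x • p • z = x • 0
      rw [smul_comm, ← hz, smul_comm, hy p hp]
      simp
    let g : Module.End R N := LinearMap.lsmul R N s
    have hg : LinearMap.range g ≤ Ideal.span {x} • (⊤ : Submodule R N) := by
      rintro _ ⟨y, rfl⟩
      obtain ⟨z, hz, h⟩ := hs' y.1 y.2
      have : g y = x • (⟨z, hz⟩ : N) := Subtype.ext h
      rw [this]
      exact Submodule.smul_mem_smul (Ideal.mem_span_singleton_self x) trivial
    obtain ⟨p, hpm, -, hc, hp0⟩ :=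
      LinearMap.exists_monic_and_natDegree_eq_and_coeff_mem_pow_and_aeval_eq_zero R g _ hg
    have hgs : g = algebraMap R (Module.End R N) s := rfl
    rw [hgs, Polynomial.aeval_algebraMap_apply] at hp0
    have h3 : Polynomial.aeval s p ∈ P := by
      rw [hm']
      have := LinearMap.congr_fun hp0 ⟨m, hmN⟩
      exact congrArg Subtype.val this
    have h4 := hPJ h3
    rw [Polynomial.aeval_eq_sum_range, Finset.sum_range_succ] at h4
    have h5 : ∑ i ∈ Finset.range p.natDegree, p.coeff i • s ^ i ∈ J := by
      refine J.sum_mem fun i hi => ?_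
      rw [smul_eq_mul]
      refine J.mul_mem_right _ ?_
      have hi' := Finset.mem_range.mp hi
      have h6 : Ideal.span {x} ^ (p.natDegree - i) ≤ J :=
        (Ideal.pow_le_self (by omega)).trans ((Ideal.span_singleton_le_iff_mem _).mpr hx)
      exact h6 (hc i)
    have h7 := (J.add_mem_iff_right h5).mp h4
    rw [hpm.coeff_natDegree, one_smul] at h7
    exact Ideal.IsPrime.mem_of_pow_mem inferInstance _ h7
  obtain ⟨Q, hQ, hQJ⟩ := Ideal.exists_minimalPrimes_le hann
  have hQa : IsAssociatedPrime Q Nb :=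
    Module.associatedPrimes.minimalPrimes_annihilator_subset_associatedPrimes R Nb hQ
  refine ⟨Q, hQa.map_of_injective Nb.subtype Nb.injective_subtype, ?_, ?_, hQJ⟩
  · intro p hp
    apply hQ.1.2
    rw [Module.mem_annihilator]
    rintro ⟨_, y, hy, rfl⟩
    apply Subtype.ext
    change p • f y = 0
    rw [← map_smul, hy p hp, map_zero]
  · apply hQ.1.2
    rw [Module.mem_annihilator]
    rintro ⟨_, y, hy, rfl⟩
    apply Subtype.ext
    change x • f y = 0
    rw [← map_smul]
    exact (Submodule.Quotient.mk_eq_zero _).mpr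
      (Submodule.smul_mem_pointwise_smul _ _ _ trivial)

theorem length_le_coheight {R : Type*} [CommRing R] [IsNoetherianRing R] (J : Ideal R)
    [J.IsPrime] (rs : List R) :
    ∀ {M : Type _} [AddCommGroup M] [Module R M] [Module.Finite R M] (P : PrimeSpectrum R)
    (_ : IsAssociatedPrime P.asIdeal M) (_ : P.asIdeal ≤ J) (_ : ∀ x ∈ rs, x ∈ J)
    (_ : RingTheory.Sequence.IsWeaklyRegular M rs), (rs.length : ℕ∞) ≤ Order.coheight P := by
  induction rs with
  | nil => intros; simp
  | cons x rs ih =>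
    intro M _ _ _ P hP hPJ hx hreg
    obtain ⟨h1, h2⟩ := (RingTheory.Sequence.isWeaklyRegular_cons_iff M x rs).mp hreg
    obtain ⟨Q, hQ, hPQ, hxQ, hQJ⟩ := step_assoc J P.asIdeal hP hPJ x (hx x (by simp)) h1
    have hlen := ih (M := QuotSMulTop x M) ⟨Q, hQ.isPrime⟩ hQ hQJ
      (fun y hy => hx y (by simp [hy])) h2
    have hlt : P < ⟨Q, hQ.isPrime⟩ := by
      refine lt_of_le_of_ne hPQ ?_
      rintro rfl
      obtain ⟨hPp, m, hm⟩ := isAssociatedPrime_iff.mp hP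
      have hx0 : x • m = 0 := by
        have : x ∈ Submodule.colon (⊥ : Submodule R M) {m} := hm ▸ hxQ
        simpa [Submodule.mem_colon_singleton] using this
      have hm0 : m = 0 := h1 (by simpa using hx0)
      apply hPp.ne_top
      rw [hm, hm0]
      ext; simp [Submodule.mem_colon_singleton]
    calc ((x :: rs).length : ℕ∞) = rs.length + 1 := by simp
      _ ≤ Order.coheight (⟨Q, hQ.isPrime⟩ : PrimeSpectrum R) + 1 := by gcongr
      _ ≤ Order.coheight P := Order.coheight_add_one_le hlt

theorem coheight_le_ringKrullDim {R : Type*} [CommRing R] (P : PrimeSpectrum R) :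
    (Order.coheight P : WithBot ℕ∞) ≤ ringKrullDim (R ⧸ P.asIdeal) := by
  rw [ringKrullDim_quotient, Order.coheight_eq_krullDim_Ici]
  apply le_of_eq
  congr 1

section Graph
variable {K : Type} [Field K] {V : Type} (Adj : V → V → Prop) (D : Finset V)

noncomputable def killD (K : Type) [Field K] {V : Type} (D : Finset V) :
    MvPolynomial V K →ₐ[K] MvPolynomial D K :=
  killCompl (Subtype.val_injective : Function.Injective (Subtype.val : D → V))

theorem killD_X_mem (v : D) : killD K D (X v.1) = X v := by
  have := killCompl_rename_app (R := K)
    (Subtype.val_injective : Function.Injective (Subtype.val : D → V)) (X v)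
  rwa [rename_X] at this

theorem killD_X_notMem {v : V} (hv : v ∉ D) : killD K D (X v) = 0 := by
  simp [killD, killCompl, hv]

theorem killD_surj : Function.Surjective (killD K D) := fun p =>
  ⟨_, killCompl_rename_app (Subtype.val_injective : Function.Injective (Subtype.val : D → V)) p⟩

theorem killD_edge (hind : ∀ a ∈ D, ∀ b ∈ D, ¬ Adj a b) (f : MvPolynomial V K)
    (hf : f ∈ edgeIdeal K Adj) : killD K D f = 0 := by
  have : edgeIdeal K Adj ≤ RingHom.ker (killD K D) := by
    refine Ideal.span_le.mpr ?_
    rintro _ ⟨a, b, hab, rfl⟩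
    change killD K D (X a * X b) = 0
    rw [map_mul]
    by_cases ha : a ∈ D
    · have hb : b ∉ D := fun hb => hind a ha b hb hab
      rw [killD_X_notMem D hb, mul_zero]
    · rw [killD_X_notMem D ha, zero_mul]
  exact this hf

theorem rdepth_le [Finite V] (hind : ∀ a ∈ D, ∀ b ∈ D, ¬ Adj a b)
    (hdom : ∀ v ∉ D, ∃ d ∈ D, Adj v d) :
    rdepth K V (MvPolynomial V K ⧸ edgeIdeal K Adj) ≤ D.card := by
  classical
  refine csSup_le' ?_
  rintro _ ⟨rs, rfl, hrs, hreg⟩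
  let P : PrimeSpectrum (MvPolynomial V K) :=
    ⟨RingHom.ker (killD K D), RingHom.ker_isPrime _⟩
  let J : Ideal (MvPolynomial V K) := RingHom.ker (constantCoeff (σ := V) (R := K))
  have : J.IsPrime := RingHom.ker_isPrime _
  have hPJ : P.asIdeal ≤ J := by
    intro f hf
    have hc : (constantCoeff (σ := D) (R := K)).comp (killD K D).toRingHom
        = constantCoeff (σ := V) (R := K) := by
      apply MvPolynomial.ringHom_ext
      · intro r; simp [killD]
      · intro v
        by_cases hv : v ∈ D
        · have := killD_X_mem (K := K) D ⟨v, hv⟩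
          simp only [] at this
          simp [this]
        · simp [killD_X_notMem D hv]
    change constantCoeff f = 0
    rw [← hc]
    have hf' : killD K D f = 0 := hf
    simp [hf']
  have hJ : ∀ x ∈ rs, x ∈ J := by
    intro x hx
    have : Ideal.span (Set.range (X : V → MvPolynomial V K)) ≤ J := by
      refine Ideal.span_le.mpr ?_
      rintro _ ⟨v, rfl⟩
      exact constantCoeff_X (R := K) v
    exact this (hrs x hx)
  let u : MvPolynomial V K := ∏ d ∈ D, X d
  have hu : killD K D u ≠ 0 := by
    rw [map_prod, Finset.prod_ne_zero_iff]
    intro d hd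
    rw [killD_X_mem D ⟨d, hd⟩]
    exact X_ne_zero _
  have hass : IsAssociatedPrime P.asIdeal (MvPolynomial V K ⧸ edgeIdeal K Adj) := by
    rw [isAssociatedPrime_iff]
    refine ⟨P.isPrime, Ideal.Quotient.mk _ u, ?_⟩
    ext f
    have e1 : f ∈ Submodule.colon (⊥ : Submodule (MvPolynomial V K) 
        (MvPolynomial V K ⧸ edgeIdeal K Adj)) {Ideal.Quotient.mk _ u} ↔
        f * u ∈ edgeIdeal K Adj := by
      rw [Submodule.mem_colon_singleton, Submodule.mem_bot, ← Ideal.Quotient.eq_zero_iff_mem]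
      rfl
    rw [e1]
    change killD K D f = 0 ↔ _
    constructor
    · intro hf
      let C : Ideal (MvPolynomial V K) := Submodule.colon (edgeIdeal K Adj) {u}
      have hC : ∀ g, g ∈ C ↔ g * u ∈ edgeIdeal K Adj := by
        intro g; rw [Submodule.mem_colon_singleton]; rfl
      have heq : ((Ideal.Quotient.mkₐ K C).comp
          (rename (Subtype.val : D → V))).comp (killD K D) = Ideal.Quotient.mkₐ K C := by
        apply MvPolynomial.algHom_ext
        intro v
        by_cases hv : v ∈ D
        · have := killD_X_mem (K := K) D ⟨v, hv⟩
          simp only [] at this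
          simp [this]
        · rw [AlgHom.comp_apply, killD_X_notMem D hv, map_zero]
          symm
          apply Ideal.Quotient.eq_zero_iff_mem.mpr
          rw [hC]
          obtain ⟨d, hd, hvd⟩ := hdom v hv
          have : u = X d * ∏ e ∈ D.erase d, X e := (Finset.mul_prod_erase D _ hd).symm
          rw [this, ← mul_assoc]
          exact Ideal.mul_mem_right _ _ (Ideal.subset_span ⟨v, d, hvd, rfl⟩)
      have := AlgHom.congr_fun heq f
      rw [AlgHom.comp_apply, hf, map_zero] at this
      rw [← hC]
      exact Ideal.Quotient.eq_zero_iff_mem.mp this.symm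
    · intro hf
      have := killD_edge Adj D hind _ hf
      rw [map_mul] at this
      exact (mul_eq_zero.mp this).resolve_right hu
  have h1 := length_le_coheight J rs P hass hPJ hJ hreg.toIsWeaklyRegular
  have h2 := coheight_le_ringKrullDim P
  have h3 : ringKrullDim (MvPolynomial V K ⧸ P.asIdeal) = (D.card : WithBot ℕ∞) := by
    have e := RingHom.quotientKerEquivOfSurjective
      (f := (killD K D).toRingHom) (killD_surj D)
    have h := ringKrullDim_eq_of_ringEquiv e
    refine Eq.trans h ?_
    rw [MvPolynomial.ringKrullDim_of_isNoetherianRing, ringKrullDim_eq_zero_of_field]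
    simp
  rw [h3] at h2
  have h4 : ((rs.length : ℕ∞) : WithBot ℕ∞) ≤ (D.card : WithBot ℕ∞) :=
    (WithBot.coe_le_coe.mpr h1).trans h2
  exact_mod_cast h4

theorem sdepth_le [Finite V] (hind : ∀ a ∈ D, ∀ b ∈ D, ¬ Adj a b)
    (hdom : ∀ v ∉ D, ∃ d ∈ D, Adj v d) :
    sdepth K V (MvPolynomial V K ⧸ edgeIdeal K Adj) ≤ D.card := by
  classical
  refine csSup_le' ?_
  rintro _ ⟨r, w, A, ⟨hfree, -, htop⟩, rfl⟩
  -- some `A i` contains `D`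
  have hex : ∃ i, D ⊆ A i := by
    by_contra hno
    push Not at hno
    have hb : ∀ i, ∃ b : D, b.1 ∉ A i := by
      intro i
      obtain ⟨b, hb, hb'⟩ := Finset.not_subset.mp (hno i)
      exact ⟨⟨b, hb⟩, hb'⟩
    choose b hb using hb
    let ψ : (MvPolynomial V K ⧸ edgeIdeal K Adj) →ₐ[K] MvPolynomial D K :=
      Ideal.Quotient.liftₐ _ (killD K D) (fun a ha => killD_edge Adj D hind a ha)
    have hψ : ∀ f : MvPolynomial V K, ψ (Ideal.Quotient.mk _ f) = killD K D f := fun f => rfl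
    let N : ℕ := (∑ i, degreeOf (b i) (ψ (w i))) + 1
    let e : D →₀ ℕ := Finsupp.equivFunOnFinite.symm (fun _ => N)
    let L : (MvPolynomial V K ⧸ edgeIdeal K Adj) →ₗ[K] K :=
      (lcoeff K e).comp ψ.toLinearMap
    have hL : ∀ y, L y = coeff e (ψ y) := fun y => rfl
    have hle : (⨆ i, stanleySpace K V (MvPolynomial V K ⧸ edgeIdeal K Adj) (w i) (A i))
        ≤ LinearMap.ker L := by
      refine iSup_le fun i => Submodule.span_le.mpr ?_
      rintro _ ⟨u, hu, rfl⟩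
      change L _ = 0
      have h1 : ψ ((monomial u (1 : K) : MvPolynomial V K) • w i)
          = killD K D (monomial u 1) * ψ (w i) := by
        rw [← hψ, ← map_mul]; rfl
      rw [hL, h1]
      by_contra hne
      have h2 : e (b i) ≤ degreeOf (b i) (killD K D (monomial u 1) * ψ (w i)) :=
        monomial_le_degreeOf _ (mem_support_iff.mpr hne)
      have h3 : degreeOf (b i) (killD K D (monomial u (1 : K))) = 0 := by
        rw [monomial_eq, map_mul, Finsupp.prod, map_prod]
        have hC : killD K D (C 1) = 1 := by simp
        rw [hC, one_mul]
        refine Nat.le_zero.mp ((degreeOf_prod_le _ _ _).trans ?_)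
        refine (Finset.sum_eq_zero fun v hv => ?_).le
        rw [map_pow]
        refine Nat.le_zero.mp ((degreeOf_pow_le _ _ _).trans ?_)
        have hvA : v ∈ A i := hu hv
        have : degreeOf (b i) (killD K D (X v : MvPolynomial V K)) = 0 := by
          by_cases hvD : v ∈ D
          · rw [killD_X_mem D ⟨v, hvD⟩, degreeOf_X_of_ne]
            rintro h
            exact hb i (by rw [h]; exact hvA)
          · rw [killD_X_notMem D hvD, degreeOf_zero]
        rw [this, mul_zero]
      have h4 := degreeOf_mul_le (b i) (killD K D (monomial u (1 : K))) (ψ (w i))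
      have h5 : degreeOf (b i) (ψ (w i)) ≤ ∑ i, degreeOf (b i) (ψ (w i)) :=
        Finset.single_le_sum (f := fun i => degreeOf (b i) (ψ (w i)))
          (fun _ _ => Nat.zero_le _) (Finset.mem_univ i)
      have h6 : e (b i) = N := rfl
      omega
    rw [htop] at hle
    obtain ⟨g, hg⟩ := killD_surj (K := K) D (monomial e 1)
    have : L (Ideal.Quotient.mk _ g) = 0 := hle trivial
    rw [hL, hψ, hg, coeff_monomial] at this
    simp at this
  obtain ⟨i, hi⟩ := hex
  have hsub : A i ⊆ D := by
    intro v hv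
    by_contra hvD
    obtain ⟨d, hd, hvd⟩ := hdom v hvD
    have h0 : (X v * X d : MvPolynomial V K) = 0 := by
      apply hfree i
      · refine (Finset.coe_subset.mpr (vars_mul _ _)).trans ?_
        intro z hz
        simp only [vars_X, Finset.coe_union, Finset.coe_singleton, Set.mem_union,
          Set.mem_singleton_iff] at hz
        rcases hz with rfl | rfl
        · exact hv
        · exact hi hd
      · obtain ⟨p, hp⟩ := Ideal.Quotient.mk_surjective (w i)
        rw [← hp]
        change Ideal.Quotient.mk _ (X v * X d * p) = 0
        rw [Ideal.Quotient.eq_zero_iff_mem]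
        exact Ideal.mul_mem_right _ _ (Ideal.subset_span ⟨v, d, hvd, rfl⟩)
    exact mul_ne_zero (X_ne_zero v) (X_ne_zero d) h0
  exact (Nat.sInf_le (Set.mem_range_self i)).trans (Finset.card_le_card hsub)

end Graph

theorem depth_sdepth_quotient_edgeIdeal_P_le (K : Type) [Field K] (n m : ℕ)
    (hn : 2 ≤ n) (hm : 1 ≤ m) :
    rdepth K (Fin n × Fin m)
        (MvPolynomial (Fin n × Fin m) K ⧸ edgeIdeal K (pAdj n m)) ≤
      ((n + 2) / 3) * ((m + 2) / 3) ∧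
    sdepth K (Fin n × Fin m)
        (MvPolynomial (Fin n × Fin m) K ⧸ edgeIdeal K (pAdj n m)) ≤
      ((n + 2) / 3) * ((m + 2) / 3) := by
  classical
  have key : ∀ k : ℕ, 1 ≤ k → ∃ E : Finset (Fin k), E.card ≤ (k + 2) / 3 ∧
      (∀ a ∈ E, ∀ b ∈ E, |((a : ℕ) : ℤ) - ((b : ℕ) : ℤ)| ≤ 1 → a = b) ∧
      (∀ a : Fin k, ∃ b ∈ E, |((a : ℕ) : ℤ) - ((b : ℕ) : ℤ)| ≤ 1) := by
    intro k hk
    let g : ℕ → Fin k := fun t => ⟨min (3 * t + 1) (k - 1), by omega⟩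
    refine ⟨(Finset.range ((k + 2) / 3)).image g, ?_, ?_, ?_⟩
    · exact Finset.card_image_le.trans (by simp)
    · intro a ha b hb hab
      obtain ⟨s, hs, rfl⟩ := Finset.mem_image.mp ha
      obtain ⟨t, ht, rfl⟩ := Finset.mem_image.mp hb
      rw [Finset.mem_range] at hs ht
      rw [abs_le] at hab
      simp only [g] at hab
      have : s = t := by omega
      rw [this]
    · intro a
      refine ⟨g (a / 3), Finset.mem_image_of_mem _ ?_, ?_⟩
      · rw [Finset.mem_range]; have := a.2; omega
      · rw [abs_le]; have := a.2; simp only [g]; omega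
  obtain ⟨E, hE, hEi, hEd⟩ := key n (by omega)
  obtain ⟨F, hF, hFi, hFd⟩ := key m hm
  have hcard : (E ×ˢ F).card ≤ ((n + 2) / 3) * ((m + 2) / 3) := by
    rw [Finset.card_product]; exact Nat.mul_le_mul hE hF
  have hind : ∀ a ∈ E ×ˢ F, ∀ b ∈ E ×ˢ F, ¬ pAdj n m a b := by
    rintro ⟨a1, a2⟩ ha ⟨b1, b2⟩ hb ⟨hne, h1, h2⟩
    rw [Finset.mem_product] at ha hb
    exact hne (Prod.ext (hEi _ ha.1 _ hb.1 h1) (hFi _ ha.2 _ hb.2 h2))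
  have hdom : ∀ v ∉ E ×ˢ F, ∃ d ∈ E ×ˢ F, pAdj n m v d := by
    rintro ⟨a, b⟩ hv
    obtain ⟨c, hc, hac⟩ := hEd a
    obtain ⟨d, hd, hbd⟩ := hFd b
    have hcd : (c, d) ∈ E ×ˢ F := Finset.mem_product.mpr ⟨hc, hd⟩
    exact ⟨(c, d), hcd, fun h => hv (h ▸ hcd), hac, hbd⟩
  exact ⟨(rdepth_le _ _ hind hdom).trans hcard, (sdepth_le _ _ hind hdom).trans hcard⟩
end
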